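/- Let k ≥ 1, s = 2k, and let K, L, M, N be natural numbers with L ≤ M ≤ N, s ≤ M, K ≤ M and K ≤ N. Let P₂(s), the Gram matrices G_{sM}, G_{sN} with entries M^{|π⊔σ|}, N^{|π⊔σ|} (assumed invertible, with inverses W_{sM}, W_{sN}), and the measure μ (the pushforward of Haar measure on O(M)×O(N) under (A,B) ↦ A·J·Bᵀ) be as in the Weingarten formula setup. Let α : Fin K → Fin M and β : Fin K → Fin N be injective, and define χ(U) = ∑_{t : Fin K} U_{α(t), β(t)}. Then ∫ χ(U)^s dμ(U) = ∑_{π,σ,τ,ν ∈ P₂(s)} K^{|π ⊔ τ|} L^{|σ ⊔ ν|} W_{sM}(π,σ) W_{sN}(τ,ν). -/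

import Mathlib

open Matrix MeasureTheory
open scoped Classical

noncomputable instance matrixMeasurableSpace {m n α : Type*} [MeasurableSpace α] :
    MeasurableSpace (Matrix m n α) :=
  inferInstanceAs (MeasurableSpace (m → n → α))

instance setoidFinite {α : Type*} [Finite α] : Finite (Setoid α) :=
  Finite.of_injective (fun s : Setoid α => s.r) fun a b h => by
    cases a; cases b; simp only at h; subst h; rfl

noncomputable instance setoidFintype {α : Type*} [Finite α] : Fintype (Setoid α) :=
  Fintype.ofFinite _

/-- A pairing: an equivalence relation all of whose classes have exactly 2 elements. -/
def IsPairing {n : ℕ} (π : Setoid (Fin n)) : Prop :=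
  ∀ x, Nat.card {y // π.r x y} = 2

/-- The indicator that the multi-index `i` is constant on the classes of `r`. -/
noncomputable def pairTensor {s n : ℕ} (r : Setoid (Fin s)) (i : Fin s → Fin n) : ℝ :=
  if r ≤ Setoid.ker i then 1 else 0

/-- Invariance of a tensor in `(ℝⁿ)^{⊗ s}`, given by its coordinates, under `O(n)`. -/
def OrthInvariant {s n : ℕ} (f : (Fin s → Fin n) → ℝ) : Prop :=
  ∀ R ∈ Matrix.orthogonalGroup (Fin n) ℝ, ∀ i, ∑ j, (∏ a, R (i a) (j a)) * f j = f i

theorem sum_pairTensor_mul {s n : ℕ} (r : Setoid (Fin s)) (F : (Fin s → Fin n) → ℝ) :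
    ∑ j, pairTensor r j * F j = ∑ e : Quotient r → Fin n, F fun a => e (Quotient.mk r a) := by
  symm
  refine Fintype.sum_of_injective (fun (e : Quotient r → Fin n) a => e (Quotient.mk r a))
    ?_ _ _ ?_ ?_
  · intro e e' h
    funext x
    induction x using Quotient.inductionOn with
    | h a => exact congrFun h a
  · intro j hj
    rw [pairTensor, if_neg, zero_mul]
    intro hr
    exact hj ⟨fun x => Quotient.lift j (fun a b hab => hr hab) x, rfl⟩
  · intro e
    rw [pairTensor, if_pos, one_mul]
    intro a b hab
    exact congrArg e (Quotient.sound hab)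

theorem sum_pairTensor {s n : ℕ} (r : Setoid (Fin s)) :
    ∑ j : Fin s → Fin n, pairTensor r j = (n : ℝ) ^ Nat.card (Quotient r) := by
  have := sum_pairTensor_mul (n := n) r fun _ => 1
  simpa [Nat.card_eq_fintype_card] using this

theorem pairTensor_mul {s n : ℕ} (r r' : Setoid (Fin s)) (i : Fin s → Fin n) :
    pairTensor r i * pairTensor r' i = pairTensor (r ⊔ r') i := by
  simp only [pairTensor, sup_le_iff, ite_and]
  split_ifs <;> simp

theorem pairTensor_comp {s n m : ℕ} (r : Setoid (Fin s)) {g : Fin n → Fin m}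
    (hg : Function.Injective g) (i : Fin s → Fin n) :
    pairTensor r (fun a => g (i a)) = pairTensor r i := by
  have : Setoid.ker (fun a => g (i a)) = Setoid.ker i := by
    ext a b
    exact hg.eq_iff
  simp only [pairTensor, this]

theorem IsPairing.exists_class {s : ℕ} {π : Setoid (Fin s)} (hπ : IsPairing π) (x : Quotient π) :
    ∃ a b, a ≠ b ∧ ({c | Quotient.mk π c = x} : Finset (Fin s)) = {a, b} := by
  rw [← Finset.card_eq_two]
  induction x using Quotient.inductionOn with
  | h a =>
    rw [← hπ a, Nat.card_eq_fintype_card, Fintype.card_subtype]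
    congr 1
    ext c
    simp only [Finset.mem_filter, Finset.mem_univ, true_and]
    exact ⟨fun h => π.symm (Quotient.exact h), fun h => Quotient.sound (π.symm h)⟩

theorem pairTensor_orthInvariant {s n : ℕ} {π : Setoid (Fin s)} (hπ : IsPairing π) :
    OrthInvariant (pairTensor (n := n) π) := by
  intro R hR i
  have hRR : ∀ x y, ∑ r, R x r * R y r = if x = y then 1 else 0 := by
    intro x y
    have := congrFun (congrFun ((Matrix.mem_orthogonalGroup_iff _ _).1 hR) x) y
    simpa [Matrix.mul_apply, Matrix.one_apply] using this
  simp only [mul_comm _ (pairTensor π _)]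
  rw [sum_pairTensor_mul]
  have h1 : ∀ e : Quotient π → Fin n, ∏ a, R (i a) (e (Quotient.mk π a))
      = ∏ x : Quotient π, ∏ a with Quotient.mk π a = x, R (i a) (e x) := by
    intro e
    rw [← Finset.prod_fiberwise Finset.univ (Quotient.mk π)]
    refine Finset.prod_congr rfl fun x _ => Finset.prod_congr rfl fun a ha => ?_
    rw [(Finset.mem_filter.1 ha).2]
  simp only [h1]
  rw [← Fintype.prod_sum (fun (x : Quotient π) (r : Fin n) =>
    ∏ a with Quotient.mk π a = x, R (i a) r)]
  have h2 : ∀ x : Quotient π, ∑ r, ∏ a with Quotient.mk π a = x, R (i a) r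
      = if ∀ a b, Quotient.mk π a = x → Quotient.mk π b = x → i a = i b then 1 else 0 := by
    intro x
    obtain ⟨a, b, hab, hx⟩ := hπ.exists_class x
    rw [hx]
    simp only [Finset.prod_pair hab, hRR]
    have hm : ∀ c, Quotient.mk π c = x ↔ c = a ∨ c = b := by
      intro c
      have : c ∈ ({c | Quotient.mk π c = x} : Finset (Fin s)) ↔ c ∈ ({a, b} : Finset (Fin s)) := by
        rw [hx]
      simpa using this
    congr 1
    refine propext ⟨fun h c d hc hd => ?_, fun h => h a b ((hm a).2 (.inl rfl)) ((hm b).2 (.inr rfl))⟩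
    rcases (hm c).1 hc with rfl | rfl <;> rcases (hm d).1 hd with rfl | rfl <;> simp [h]
  simp only [h2]
  rw [Finset.prod_ite_zero, pairTensor, Finset.prod_const_one]
  congr 1
  refine propext ⟨fun h a b hab => h (Quotient.mk π a) (Finset.mem_univ _) a b rfl
    (Quotient.sound (π.symm hab)), fun h x _ a b ha hb => h (Quotient.exact (ha.trans hb.symm))⟩

theorem OrthInvariant.sub_sum {s n : ℕ} {ι : Type*} [Fintype ι] {f : (Fin s → Fin n) → ℝ}
    (hf : OrthInvariant f) {T : ι → (Fin s → Fin n) → ℝ} (hT : ∀ x, OrthInvariant (T x))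
    (c : ι → ℝ) : OrthInvariant fun i => f i - ∑ x, c x * T x i := by
  intro R hR i
  simp only [mul_sub, Finset.sum_sub_distrib, Finset.mul_sum]
  rw [hf R hR i, Finset.sum_comm]
  congr 1
  refine Finset.sum_congr rfl fun x _ => ?_
  rw [← hT x R hR i, Finset.mul_sum]
  exact Finset.sum_congr rfl fun j _ => by ring

theorem OrthInvariant.comp_perm {s n : ℕ} {f : (Fin s → Fin n) → ℝ} (hf : OrthInvariant f)
    (σ : Equiv.Perm (Fin n)) (i : Fin s → Fin n) : f (fun a => σ (i a)) = f i := by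
  have hR : Matrix.of (fun x y => if y = σ x then (1 : ℝ) else 0) ∈
      Matrix.orthogonalGroup (Fin n) ℝ := by
    rw [Matrix.mem_orthogonalGroup_iff]
    ext x y
    simp [Matrix.mul_apply, Matrix.one_apply]
    simp [eq_comm]
  rw [← hf _ hR i, Finset.sum_eq_single fun a => σ (i a)]
  · simp
  · intro j _ hj
    obtain ⟨a, ha⟩ := Function.ne_iff.1 hj
    rw [Finset.prod_eq_zero (Finset.mem_univ a), zero_mul]
    exact if_neg ha
  · simp

theorem OrthInvariant.eq_zero_of_odd {s n : ℕ} {f : (Fin s → Fin n) → ℝ} (hf : OrthInvariant f)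
    (i : Fin s → Fin n) (p : Fin n) (hp : Odd (Finset.card {b | i b = p})) : f i = 0 := by
  have hR : Matrix.diagonal (fun x : Fin n => if x = p then (-1 : ℝ) else 1) ∈
      Matrix.orthogonalGroup (Fin n) ℝ := by
    rw [Matrix.mem_orthogonalGroup_iff, Matrix.diagonal_transpose, Matrix.diagonal_mul_diagonal,
      ← Matrix.diagonal_one]
    congr 1
    funext x
    split_ifs <;> simp
  have h := hf _ hR i
  rw [Finset.sum_eq_single i] at h
  · simp only [Matrix.diagonal_apply_eq] at h
    rw [Finset.prod_ite, Finset.prod_const, Finset.prod_const_one, hp.neg_one_pow] at h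
    linarith
  · intro j _ hj
    obtain ⟨a, ha⟩ := Function.ne_iff.1 hj
    rw [Finset.prod_eq_zero (Finset.mem_univ a), zero_mul]
    exact Matrix.diagonal_apply_ne _ (Ne.symm ha)
  · simp

/-- Rotation by the angle `θ` in the plane of the coordinates `p` and `q`. -/
noncomputable def planeRotation {n : ℕ} (p q : Fin n) (θ : ℝ) : Matrix (Fin n) (Fin n) ℝ :=
  1 + (Real.cos θ - 1) • (Matrix.single p p 1 + Matrix.single q q 1)
    + Real.sin θ • (Matrix.single p q 1 - Matrix.single q p 1)

theorem planeRotation_mem {n : ℕ} {p q : Fin n} (hpq : p ≠ q) (θ : ℝ) :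
    planeRotation p q θ ∈ Matrix.orthogonalGroup (Fin n) ℝ := by
  rw [Matrix.mem_orthogonalGroup_iff, planeRotation]
  simp only [Matrix.transpose_add, Matrix.transpose_sub, Matrix.transpose_smul,
    Matrix.transpose_one, Matrix.transpose_single]
  simp only [mul_add, add_mul, mul_sub, sub_mul, mul_one, one_mul, smul_mul_assoc, mul_smul_comm,
    Matrix.single_mul_single_same, Matrix.single_mul_single_of_ne _ _ _ _ hpq,
    Matrix.single_mul_single_of_ne _ _ _ _ hpq.symm]
  have h := Real.sin_sq_add_cos_sq θ
  have h' : Real.sin θ * Real.sin θ = 1 - Real.cos θ * Real.cos θ := by linarith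
  simp only [add_zero, zero_add, sub_zero, zero_sub, smul_add, smul_sub, smul_smul, smul_neg, h']
  module

theorem hasDerivAt_planeRotation {n : ℕ} (p q x y : Fin n) :
    HasDerivAt (fun θ => planeRotation p q θ x y)
      ((Matrix.single p q 1 - Matrix.single q p 1 : Matrix (Fin n) (Fin n) ℝ) x y) 0 := by
  have hc := ((Real.hasDerivAt_cos 0).sub_const 1).mul_const
    ((Matrix.single p p 1 + Matrix.single q q 1 : Matrix (Fin n) (Fin n) ℝ) x y)
  have hs := (Real.hasDerivAt_sin 0).mul_const
    ((Matrix.single p q 1 - Matrix.single q p 1 : Matrix (Fin n) (Fin n) ℝ) x y)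
  have := (hc.const_add ((1 : Matrix (Fin n) (Fin n) ℝ) x y)).add hs
  simp only [Real.sin_zero, Real.cos_zero, neg_zero, zero_mul, one_mul, zero_add] at this
  exact this

theorem sum_prod_erase_one_mul {s n : ℕ} (i : Fin s → Fin n) (a : Fin s)
    (F : (Fin s → Fin n) → ℝ) :
    ∑ j, (∏ b ∈ Finset.univ.erase a, (1 : Matrix (Fin n) (Fin n) ℝ) (i b) (j b)) * F j
      = ∑ r, F (Function.update i a r) := by
  symm
  refine Fintype.sum_of_injective (fun r => Function.update i a r)
    (Function.update_injective i a) _ _ ?_ ?_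
  · intro j hj
    obtain ⟨b, hb, hne⟩ : ∃ b, b ≠ a ∧ i b ≠ j b := by
      by_contra! hcon
      exact hj ⟨j a, funext fun b => by
        by_cases hb : b = a
        · subst hb; simp
        · simp [hb, hcon b hb]⟩
    rw [Finset.prod_eq_zero (Finset.mem_erase.2 ⟨hb, Finset.mem_univ b⟩), zero_mul]
    exact Matrix.one_apply_ne hne
  · intro r
    rw [Finset.prod_eq_one, one_mul]
    intro b hb
    rw [Function.update_of_ne (Finset.ne_of_mem_erase hb)]
    exact Matrix.one_apply_eq _

theorem OrthInvariant.infinitesimal {s n : ℕ} {f : (Fin s → Fin n) → ℝ} (hf : OrthInvariant f)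
    {p q : Fin n} (hpq : p ≠ q) (i : Fin s → Fin n) :
    ∑ b with i b = p, f (Function.update i b q) = ∑ b with i b = q, f (Function.update i b p) := by
  have hd : HasDerivAt (fun θ => ∑ j, (∏ a, planeRotation p q θ (i a) (j a)) * f j)
      (∑ j, (∑ a, (∏ b ∈ Finset.univ.erase a, planeRotation p q 0 (i b) (j b)) •
        (Matrix.single p q 1 - Matrix.single q p 1 : Matrix (Fin n) (Fin n) ℝ) (i a) (j a)) * f j)
      0 :=
    HasDerivAt.fun_sum fun j _ => (HasDerivAt.fun_finsetProd fun a _ =>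
      hasDerivAt_planeRotation p q (i a) (j a)).mul_const (f j)
  have hc : (fun θ => ∑ j, (∏ a, planeRotation p q θ (i a) (j a)) * f j) = fun _ => f i :=
    funext fun θ => hf _ (planeRotation_mem hpq θ) i
  rw [hc] at hd
  have h0 := hd.unique (hasDerivAt_const 0 (f i))
  have hR0 : planeRotation p q 0 = 1 := by simp [planeRotation]
  simp only [hR0, smul_eq_mul, Finset.sum_mul] at h0
  rw [Finset.sum_comm] at h0
  simp only [mul_assoc] at h0
  simp only [sum_prod_erase_one_mul i _ fun j =>
    (Matrix.single p q 1 - Matrix.single q p 1 : Matrix (Fin n) (Fin n) ℝ) _ (j _) * f j] at h0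
  rw [← sub_eq_zero, ← h0, Finset.sum_filter, Finset.sum_filter, ← Finset.sum_sub_distrib]
  refine Finset.sum_congr rfl fun a _ => ?_
  simp only [Function.update_self, Matrix.sub_apply, Matrix.single_apply, sub_mul,
    Finset.sum_sub_distrib, ite_and, ite_mul, one_mul, zero_mul]
  congr 1 <;> simp [eq_comm]

theorem OrthInvariant.eq_zero_of_forall_card_eq_two {s n : ℕ} (hsn : s ≤ n)
    {f : (Fin s → Fin n) → ℝ} (hf : OrthInvariant f)
    (h0 : ∀ i : Fin s → Fin n, (∀ a, Finset.card {b | i b = i a} = 2) → f i = 0)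
    (i : Fin s → Fin n) : f i = 0 := by
  induction hd : n - (Finset.univ.image i).card using Nat.strong_induction_on generalizing i with
  | _ d ih =>
  subst hd
  by_cases hodd : ∃ a, Odd (Finset.card {b | i b = i a})
  · obtain ⟨a, ha⟩ := hodd
    exact hf.eq_zero_of_odd i (i a) ha
  simp only [not_exists, Nat.not_odd_iff_even] at hodd
  by_cases htwo : ∀ a, Finset.card {b | i b = i a} = 2
  · exact h0 i htwo
  obtain ⟨a, ha⟩ := not_forall.1 htwo
  have hge : ∀ a, 2 ≤ Finset.card {b | i b = i a} := by
    intro a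
    have hpos : 0 < Finset.card {b | i b = i a} := Finset.card_pos.2 ⟨a, by simp⟩
    obtain ⟨m, hm⟩ := hodd a
    omega
  have hfour : 2 < Finset.card {b | i b = i a} := by
    have := hge a
    omega
  have himage : (Finset.univ.image i).card * 2 ≤ s := by
    have := Finset.mul_card_image_le_card (f := i) Finset.univ 2 (by
      intro p hp
      obtain ⟨c, -, rfl⟩ := Finset.mem_image.1 hp
      exact hge c)
    simpa [mul_comm] using this
  have hspos : 0 < s := a.pos
  have hlt : (Finset.univ.image i).card < (Finset.univ : Finset (Fin n)).card := by
    rw [Finset.card_univ, Fintype.card_fin]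
    omega
  obtain ⟨q, -, hq⟩ := Finset.exists_mem_notMem_of_card_lt_card hlt
  have hq' : ∀ c, i c ≠ q := fun c hc => hq (Finset.mem_image.2 ⟨c, Finset.mem_univ c, hc⟩)
  have key := hf.infinitesimal (hq' a) (Function.update i a q)
  have hfilter : ({b | Function.update i a q b = q} : Finset (Fin s)) = {a} := by
    ext b
    by_cases hb : b = a
    · subst hb; simp
    · simp [hb, hq' b]
  rw [hfilter, Finset.sum_singleton, Function.update_idem, Function.update_eq_self] at key
  rw [← key]
  refine Finset.sum_eq_zero fun b hb => ?_
  replace hb := (Finset.mem_filter.1 hb).2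
  have hba : b ≠ a := by
    rintro rfl
    simp only [Function.update_self] at hb
    exact hq' b hb.symm
  rw [Function.update_of_ne hba] at hb
  set j := Function.update (Function.update i a q) b q with hj
  have hsub : insert q (Finset.univ.image i) ⊆ Finset.univ.image j := by
    intro p hp
    rw [Finset.mem_image]
    rcases Finset.mem_insert.1 hp with rfl | hp
    · exact ⟨b, Finset.mem_univ b, by simp [hj]⟩
    obtain ⟨c, -, rfl⟩ := Finset.mem_image.1 hp
    by_cases hc : i c = i a
    · have hlt' : ({a, b} : Finset (Fin s)).card < Finset.card {b | i b = i a} :=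
        Finset.card_le_two.trans_lt hfour
      obtain ⟨d, hd, hd'⟩ := Finset.exists_mem_notMem_of_card_lt_card hlt'
      simp only [Finset.mem_insert, Finset.mem_singleton, not_or] at hd'
      refine ⟨d, Finset.mem_univ d, ?_⟩
      rw [hj, Function.update_of_ne hd'.2, Function.update_of_ne hd'.1, hc]
      exact (Finset.mem_filter.1 hd).2
    · refine ⟨c, Finset.mem_univ c, ?_⟩
      rw [hj, Function.update_of_ne (by rintro rfl; exact hc hb),
        Function.update_of_ne (by rintro rfl; exact hc rfl)]
  have hcard := Finset.card_le_card hsub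
  rw [Finset.card_insert_of_notMem hq] at hcard
  refine ih _ ?_ j rfl
  rw [Finset.card_univ, Fintype.card_fin] at hlt
  omega

theorem exists_perm_of_ker_eq {s n : ℕ} {i j : Fin s → Fin n}
    (h : Setoid.ker i = Setoid.ker j) : ∃ σ : Equiv.Perm (Fin n), (fun a => σ (i a)) = j := by
  have hij : ∀ a b, i a = i b ↔ j a = j b := fun a b =>
    ⟨fun hab => (h ▸ hab : Setoid.ker j a b), fun hab => (h ▸ hab : Setoid.ker i a b)⟩
  let e : {x // x ∈ Set.range i} ≃ {x // x ∈ Set.range j} := Equiv.ofBijective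
    (fun x => ⟨j x.2.choose, x.2.choose, rfl⟩) ⟨fun x y hxy => by
      have h1 := (hij _ _).2 (Subtype.ext_iff.1 hxy)
      rw [x.2.choose_spec, y.2.choose_spec] at h1
      exact Subtype.ext h1, fun y => by
      obtain ⟨_, a, rfl⟩ := y
      refine ⟨⟨i a, a, rfl⟩, Subtype.ext ((hij _ _).1 ?_)⟩
      exact Exists.choose_spec (⟨a, rfl⟩ : i a ∈ Set.range i)⟩
  refine ⟨e.extendSubtype, funext fun a => ?_⟩
  rw [Equiv.extendSubtype_apply_of_mem e (i a) ⟨a, rfl⟩]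
  exact (hij _ _).1 (Exists.choose_spec (⟨a, rfl⟩ : i a ∈ Set.range i))

theorem IsPairing.eq_of_le {s : ℕ} {π π' : Setoid (Fin s)} (hπ : IsPairing π)
    (hπ' : IsPairing π') (hle : π ≤ π') : π = π' := by
  refine le_antisymm hle fun a b hab => ?_
  have hcard : ∀ {ρ : Setoid (Fin s)}, IsPairing ρ → Finset.card {c | ρ a c} = 2 := by
    intro ρ hρ
    rw [← hρ a, Nat.card_eq_fintype_card, Fintype.card_subtype]
  have hsub : ({c | π a c} : Finset (Fin s)) ⊆ ({c | π' a c} : Finset (Fin s)) := fun c hc => by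
    simp only [Finset.mem_filter, Finset.mem_univ, true_and] at hc ⊢
    exact hle hc
  have heq := Finset.eq_of_subset_of_card_le hsub (by rw [hcard hπ, hcard hπ'])
  have hb : b ∈ ({c | π' a c} : Finset (Fin s)) := by simpa using hab
  rw [← heq] at hb
  exact (Finset.mem_filter.1 hb).2

/-- The first fundamental theorem for `O(n)` in the stable range: invariant tensors are spanned
by pairings. -/
theorem OrthInvariant.exists_eq_sum_pairTensor {s n : ℕ} (hsn : s ≤ n)
    {f : (Fin s → Fin n) → ℝ} (hf : OrthInvariant f) :
    ∃ c : {π : Setoid (Fin s) // IsPairing π} → ℝ,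
      ∀ i, f i = ∑ π, c π * pairTensor π.1 i := by
  have hrep : ∀ π : Setoid (Fin s), ∃ i : Fin s → Fin n, Setoid.ker i = π := by
    intro π
    have hle : Fintype.card (Quotient π) ≤ Fintype.card (Fin n) :=
      (Fintype.card_quotient_le π).trans (by simpa using hsn)
    obtain ⟨e⟩ := Function.Embedding.nonempty_of_card_le hle
    refine ⟨fun a => e (Quotient.mk π a), ?_⟩
    ext a b
    exact (e.injective.eq_iff.trans Quotient.eq)
  choose rep hker using hrep
  refine ⟨fun π => f (rep π.1), fun i => ?_⟩
  have hg := hf.sub_sum (fun π : {π : Setoid (Fin s) // IsPairing π} =>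
    pairTensor_orthInvariant (n := n) π.2) fun π => f (rep π.1)
  refine sub_eq_zero.1 (hg.eq_zero_of_forall_card_eq_two hsn (fun j hj => ?_) i)
  have hpair : IsPairing (Setoid.ker j) := by
    intro a
    rw [← hj a, Nat.card_eq_fintype_card, Fintype.card_subtype]
    congr 1
    ext b
    simp only [Finset.mem_filter, Finset.mem_univ, true_and]
    exact eq_comm
  rw [Finset.sum_eq_single ⟨Setoid.ker j, hpair⟩]
  · obtain ⟨σ, hσ⟩ := exists_perm_of_ker_eq (hker (Setoid.ker j))
    have := hf.comp_perm σ (rep (Setoid.ker j))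
    rw [hσ] at this
    rw [pairTensor, if_pos le_rfl, this]
    ring
  · intro π _ hne
    rw [pairTensor, if_neg, mul_zero]
    exact fun hle => hne (Subtype.ext (π.2.eq_of_le hpair hle))
  · simp

/-- Expansion of an invariant tensor through its contractions against pairings, for a left
inverse `W` of the Gram matrix `G`. -/
theorem OrthInvariant.eq_sum_weingarten {s n : ℕ} (hsn : s ≤ n)
    {G W : Matrix {π : Setoid (Fin s) // IsPairing π} {π : Setoid (Fin s) // IsPairing π} ℝ}
    (hG : ∀ π σ, G π σ = (n : ℝ) ^ Nat.card (Quotient (π.1 ⊔ σ.1))) (hW : W * G = 1)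
    {f : (Fin s → Fin n) → ℝ} (hf : OrthInvariant f) (i : Fin s → Fin n) :
    f i = ∑ π, ∑ σ, W π σ * pairTensor π.1 i * ∑ j, pairTensor σ.1 j * f j := by
  obtain ⟨c, hc⟩ := hf.exists_eq_sum_pairTensor hsn
  have hcontr : ∀ σ : {π : Setoid (Fin s) // IsPairing π},
      ∑ j, pairTensor σ.1 j * f j = (G *ᵥ c) σ := by
    intro σ
    simp only [hc, Finset.mul_sum, Matrix.mulVec, dotProduct, hG]
    rw [Finset.sum_comm]
    refine Finset.sum_congr rfl fun π _ => ?_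
    rw [← sum_pairTensor, Finset.sum_mul]
    refine Finset.sum_congr rfl fun j _ => ?_
    rw [← pairTensor_mul]
    ring
  have hcW : c = W *ᵥ (G *ᵥ c) := by rw [Matrix.mulVec_mulVec, hW, Matrix.one_mulVec]
  rw [hc]
  refine Finset.sum_congr rfl fun π _ => ?_
  conv_lhs => rw [hcW]
  simp only [hcontr]
  rw [Matrix.mulVec, dotProduct, Finset.sum_mul]
  exact Finset.sum_congr rfl fun σ _ => by ring

theorem prod_mul_apply {s l m n : ℕ} (A : Matrix (Fin l) (Fin m) ℝ) (Z : Matrix (Fin m) (Fin n) ℝ)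
    (i : Fin s → Fin l) (j : Fin s → Fin n) :
    ∏ a, (A * Z) (i a) (j a) = ∑ x : Fin s → Fin m, (∏ a, A (i a) (x a)) * ∏ a, Z (x a) (j a) := by
  simp only [Matrix.mul_apply]
  rw [Fintype.prod_sum fun (a : Fin s) (x : Fin m) => A (i a) x * Z x (j a)]
  simp only [Finset.prod_mul_distrib]

theorem sum_pairTensor_mul_prod_orthogonal_mul {s m n : ℕ} {π : Setoid (Fin s)} (hπ : IsPairing π)
    {A : Matrix (Fin m) (Fin m) ℝ} (hA : A ∈ Matrix.orthogonalGroup (Fin m) ℝ)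
    (Z : Matrix (Fin m) (Fin n) ℝ) (j : Fin s → Fin n) :
    ∑ i, pairTensor π i * ∏ a, (A * Z) (i a) (j a)
      = ∑ i, pairTensor π i * ∏ a, Z (i a) (j a) := by
  have hA' : Aᵀ ∈ Matrix.orthogonalGroup (Fin m) ℝ := by
    rw [Matrix.mem_orthogonalGroup_iff, Matrix.transpose_transpose]
    exact (Matrix.mem_orthogonalGroup_iff' _ _).1 hA
  simp only [prod_mul_apply, Finset.mul_sum]
  rw [Finset.sum_comm]
  refine Finset.sum_congr rfl fun x _ => ?_
  rw [← pairTensor_orthInvariant hπ _ hA' x, Finset.sum_mul]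
  refine Finset.sum_congr rfl fun i _ => ?_
  simp only [Matrix.transpose_apply]
  ring

theorem sum_pairTensor_mul_prod_orthogonal_conj {s m n : ℕ} {σ ν : Setoid (Fin s)}
    (hσ : IsPairing σ) (hν : IsPairing ν)
    {A : Matrix (Fin m) (Fin m) ℝ} (hA : A ∈ Matrix.orthogonalGroup (Fin m) ℝ)
    {B : Matrix (Fin n) (Fin n) ℝ} (hB : B ∈ Matrix.orthogonalGroup (Fin n) ℝ)
    (J : Matrix (Fin m) (Fin n) ℝ) :
    ∑ p, ∑ q, pairTensor σ p * pairTensor ν q * ∏ a, (A * J * Bᵀ) (p a) (q a)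
      = ∑ p, ∑ q, pairTensor σ p * pairTensor ν q * ∏ a, J (p a) (q a) := by
  have hright : ∀ p : Fin s → Fin m, ∑ q, pairTensor ν q * ∏ a, (J * Bᵀ) (p a) (q a)
      = ∑ q, pairTensor ν q * ∏ a, J (p a) (q a) := by
    intro p
    rw [show J * Bᵀ = (B * Jᵀ)ᵀ by simp]
    exact sum_pairTensor_mul_prod_orthogonal_mul hν hB Jᵀ p
  calc _ = ∑ q, pairTensor ν q * ∑ p, pairTensor σ p * ∏ a, (A * (J * Bᵀ)) (p a) (q a) := by
        rw [Finset.sum_comm]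
        simp only [Finset.mul_sum, Matrix.mul_assoc]
        exact Finset.sum_congr rfl fun q _ => Finset.sum_congr rfl fun p _ => by ring
    _ = ∑ p, pairTensor σ p * ∑ q, pairTensor ν q * ∏ a, (J * Bᵀ) (p a) (q a) := by
        simp only [sum_pairTensor_mul_prod_orthogonal_mul hσ hA, Finset.mul_sum]
        rw [Finset.sum_comm]
        exact Finset.sum_congr rfl fun q _ => Finset.sum_congr rfl fun p _ => by ring
    _ = _ := by
        simp only [hright, Finset.mul_sum, mul_assoc]

theorem sum_pairTensor_mul_prod_partialIdentity {s L m n : ℕ} (hLm : L ≤ m) (hmn : m ≤ n)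
    (σ ν : Setoid (Fin s)) {J : Matrix (Fin m) (Fin n) ℝ}
    (hJ : ∀ a b, J a b = if (a : ℕ) = (b : ℕ) ∧ (a : ℕ) < L then 1 else 0) :
    ∑ p, ∑ q, pairTensor σ p * pairTensor ν q * ∏ a, J (p a) (q a)
      = (L : ℝ) ^ Nat.card (Quotient (σ ⊔ ν)) := by
  rw [← sum_pairTensor, ← Fintype.sum_prod_type']
  symm
  refine Fintype.sum_of_injective (fun x : Fin s → Fin L =>
    ((fun a => Fin.castLE hLm (x a), fun a => Fin.castLE (hLm.trans hmn) (x a)) :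
      (Fin s → Fin m) × (Fin s → Fin n))) ?_ _ _ ?_ ?_
  · intro x y hxy
    funext a
    exact Fin.castLE_injective hLm (congrFun (congrArg Prod.fst hxy) a)
  · rintro ⟨p, q⟩ hpq
    obtain ⟨a, ha⟩ : ∃ a, ¬((p a : ℕ) = (q a : ℕ) ∧ (p a : ℕ) < L) := by
      by_contra! hcon
      exact hpq ⟨fun a => ⟨p a, (hcon a).2⟩,
        Prod.ext (funext fun a => Fin.ext rfl) (funext fun a => Fin.ext (hcon a).1)⟩
    rw [Finset.prod_eq_zero (Finset.mem_univ a), mul_zero]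
    rw [hJ, if_neg ha]
  · intro x
    simp only [pairTensor_comp _ (Fin.castLE_injective _), pairTensor_mul]
    rw [Finset.prod_eq_one, mul_one]
    intro a _
    simp [hJ]

theorem measurable_matrix_apply {m n : Type*} (x : m) (y : n) :
    Measurable fun U : Matrix m n ℝ => U x y :=
  (measurable_pi_apply y).comp (measurable_pi_apply (X := fun _ : m => n → ℝ) x)

theorem measurable_matrix_of_apply {Ω m n : Type*} [MeasurableSpace Ω] {f : Ω → Matrix m n ℝ}
    (hf : ∀ x y, Measurable fun ω => f ω x y) : Measurable f :=
  measurable_pi_iff.2 fun x => measurable_pi_iff.2 fun y => hf x y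

theorem measurable_matrix_mul_orthogonal {Ω : Type*} [MeasurableSpace Ω] {n : ℕ}
    (R : Matrix (Fin n) (Fin n) ℝ) {f : Ω → ↥(Matrix.orthogonalGroup (Fin n) ℝ)}
    (hf : Measurable f) : Measurable fun ω => R * (f ω : Matrix (Fin n) (Fin n) ℝ) := by
  refine measurable_matrix_of_apply fun x y => ?_
  simp only [Matrix.mul_apply]
  exact Finset.measurable_fun_sum _ fun z _ => ((measurable_matrix_apply z y).comp
    (measurable_subtype_coe.comp hf)).const_mul _

theorem measurable_matrix_orthogonal_mul {Ω : Type*} [MeasurableSpace Ω] {n : ℕ}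
    (R : Matrix (Fin n) (Fin n) ℝ) {f : Ω → ↥(Matrix.orthogonalGroup (Fin n) ℝ)}
    (hf : Measurable f) : Measurable fun ω => (f ω : Matrix (Fin n) (Fin n) ℝ) * R := by
  refine measurable_matrix_of_apply fun x y => ?_
  simp only [Matrix.mul_apply]
  exact Finset.measurable_fun_sum _ fun z _ => ((measurable_matrix_apply x z).comp
    (measurable_subtype_coe.comp hf)).mul_const _

instance measurableMul_orthogonalGroup_prod {M N : ℕ} : MeasurableMul
    (↥(Matrix.orthogonalGroup (Fin M) ℝ) × ↥(Matrix.orthogonalGroup (Fin N) ℝ)) where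
  measurable_const_mul c := by
    have h1 := measurable_matrix_mul_orthogonal (c.1 : Matrix (Fin M) (Fin M) ℝ) (measurable_fst
      (α := Matrix.orthogonalGroup (Fin M) ℝ) (β := Matrix.orthogonalGroup (Fin N) ℝ))
    have h2 := measurable_matrix_mul_orthogonal (c.2 : Matrix (Fin N) (Fin N) ℝ) (measurable_snd
      (α := Matrix.orthogonalGroup (Fin M) ℝ) (β := Matrix.orthogonalGroup (Fin N) ℝ))
    exact (h1.subtype_mk (h := fun p => (c.1 * p.1).2)).prodMk
      (h2.subtype_mk (h := fun p => (c.2 * p.2).2))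
  measurable_mul_const c := by
    have h1 := measurable_matrix_orthogonal_mul (c.1 : Matrix (Fin M) (Fin M) ℝ) (measurable_fst
      (α := Matrix.orthogonalGroup (Fin M) ℝ) (β := Matrix.orthogonalGroup (Fin N) ℝ))
    have h2 := measurable_matrix_orthogonal_mul (c.2 : Matrix (Fin N) (Fin N) ℝ) (measurable_snd
      (α := Matrix.orthogonalGroup (Fin M) ℝ) (β := Matrix.orthogonalGroup (Fin N) ℝ))
    exact (h1.subtype_mk (h := fun p => (p.1 * c.1).2)).prodMk
      (h2.subtype_mk (h := fun p => (p.2 * c.2).2))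

section Moments

variable {M N : ℕ} {J : Matrix (Fin M) (Fin N) ℝ}
  {h : Measure (↥(Matrix.orthogonalGroup (Fin M) ℝ) × ↥(Matrix.orthogonalGroup (Fin N) ℝ))}

theorem measurable_orthogonal_conj_apply (J : Matrix (Fin M) (Fin N) ℝ) (x : Fin M) (y : Fin N) :
    Measurable fun p : ↥(Matrix.orthogonalGroup (Fin M) ℝ) × ↥(Matrix.orthogonalGroup (Fin N) ℝ) =>
      ((p.1 : Matrix (Fin M) (Fin M) ℝ) * J * (p.2 : Matrix (Fin N) (Fin N) ℝ)ᵀ) x y := by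
  have h1 : ∀ a b, Measurable fun p :
      ↥(Matrix.orthogonalGroup (Fin M) ℝ) × ↥(Matrix.orthogonalGroup (Fin N) ℝ) =>
      (p.1 : Matrix (Fin M) (Fin M) ℝ) a b := fun a b =>
    (measurable_matrix_apply a b).comp (measurable_subtype_coe.comp measurable_fst)
  have h2 : ∀ a b, Measurable fun p :
      ↥(Matrix.orthogonalGroup (Fin M) ℝ) × ↥(Matrix.orthogonalGroup (Fin N) ℝ) =>
      (p.2 : Matrix (Fin N) (Fin N) ℝ) a b := fun a b =>
    (measurable_matrix_apply a b).comp (measurable_subtype_coe.comp measurable_snd)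
  simp only [Matrix.mul_apply, Matrix.transpose_apply]
  exact Finset.measurable_fun_sum _ fun b _ =>
    (Finset.measurable_fun_sum _ fun a _ => (h1 _ _).mul_const _).mul (h2 _ _)

theorem abs_orthogonal_conj_apply_le (J : Matrix (Fin M) (Fin N) ℝ)
    (p : ↥(Matrix.orthogonalGroup (Fin M) ℝ) × ↥(Matrix.orthogonalGroup (Fin N) ℝ))
    (x : Fin M) (y : Fin N) :
    |((p.1 : Matrix (Fin M) (Fin M) ℝ) * J * (p.2 : Matrix (Fin N) (Fin N) ℝ)ᵀ) x y|
      ≤ ∑ b, ∑ a, |J a b| := by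
  simp only [Matrix.mul_apply, Matrix.transpose_apply]
  refine (Finset.abs_sum_le_sum_abs _ _).trans (Finset.sum_le_sum fun b _ => ?_)
  rw [abs_mul]
  refine (mul_le_of_le_one_right (abs_nonneg _)
    (entry_norm_bound_of_unitary (𝕜 := ℝ) p.2.2 y b)).trans ?_
  refine (Finset.abs_sum_le_sum_abs _ _).trans (Finset.sum_le_sum fun a _ => ?_)
  rw [abs_mul]
  exact mul_le_of_le_one_left (abs_nonneg _) (entry_norm_bound_of_unitary (𝕜 := ℝ) p.1.2 x a)

theorem integrable_prod_orthogonal_conj {s : ℕ} [IsFiniteMeasure h]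
    (J : Matrix (Fin M) (Fin N) ℝ) (i : Fin s → Fin M) (j : Fin s → Fin N) :
    Integrable (fun p => ∏ a, ((p.1 : Matrix (Fin M) (Fin M) ℝ) * J *
      (p.2 : Matrix (Fin N) (Fin N) ℝ)ᵀ) (i a) (j a)) h := by
  refine Integrable.of_bound (Finset.measurable_fun_prod _ fun a _ =>
    measurable_orthogonal_conj_apply J (i a) (j a)).aestronglyMeasurable
    (∏ _a : Fin s, ∑ b, ∑ a, |J a b|) (Filter.Eventually.of_forall fun p => ?_)
  rw [Real.norm_eq_abs, Finset.abs_prod]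
  exact Finset.prod_le_prod (fun _ _ => abs_nonneg _) fun a _ =>
    abs_orthogonal_conj_apply_le J p (i a) (j a)

/-- The mixed moments of the entries of `A * J * Bᵀ`. -/
noncomputable def conjMoment {s : ℕ}
    (h : Measure (↥(Matrix.orthogonalGroup (Fin M) ℝ) × ↥(Matrix.orthogonalGroup (Fin N) ℝ)))
    (J : Matrix (Fin M) (Fin N) ℝ) (i : Fin s → Fin M) (j : Fin s → Fin N) : ℝ :=
  ∫ p, ∏ a, ((p.1 : Matrix (Fin M) (Fin M) ℝ) * J *
    (p.2 : Matrix (Fin N) (Fin N) ℝ)ᵀ) (i a) (j a) ∂h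

theorem conjMoment_orthInvariant_left {s : ℕ} [IsFiniteMeasure h] [h.IsMulLeftInvariant]
    (j : Fin s → Fin N) : OrthInvariant fun i => conjMoment h J i j := by
  intro R hR i
  simp only [conjMoment, ← integral_const_mul]
  rw [← integral_finsetSum _ fun x _ => (integrable_prod_orthogonal_conj J x j).const_mul _]
  simp only [← prod_mul_apply]
  rw [← integral_mul_left_eq_self (μ := h) (fun p => ∏ a, ((p.1 : Matrix (Fin M) (Fin M) ℝ) * J *
    (p.2 : Matrix (Fin N) (Fin N) ℝ)ᵀ) (i a) (j a)) (⟨R, hR⟩, 1)]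
  simp [Matrix.mul_assoc]

theorem conjMoment_orthInvariant_right {s : ℕ} [IsFiniteMeasure h] [h.IsMulLeftInvariant]
    (i : Fin s → Fin M) : OrthInvariant fun j => conjMoment h J i j := by
  intro R hR j
  simp only [conjMoment, ← integral_const_mul]
  rw [← integral_finsetSum _ fun x _ => (integrable_prod_orthogonal_conj J i x).const_mul _]
  have hp : ∀ p : ↥(Matrix.orthogonalGroup (Fin M) ℝ) × ↥(Matrix.orthogonalGroup (Fin N) ℝ),
      ∑ x : Fin s → Fin N, (∏ a, R (j a) (x a)) * ∏ a, ((p.1 : Matrix (Fin M) (Fin M) ℝ) * J *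
        (p.2 : Matrix (Fin N) (Fin N) ℝ)ᵀ) (i a) (x a)
      = ∏ a, ((p.1 : Matrix (Fin M) (Fin M) ℝ) * J *
        (R * (p.2 : Matrix (Fin N) (Fin N) ℝ))ᵀ) (i a) (j a) := by
    intro p
    rw [Matrix.transpose_mul, ← Matrix.mul_assoc, prod_mul_apply]
    exact Finset.sum_congr rfl fun x _ => mul_comm _ _
  simp only [hp]
  rw [← integral_mul_left_eq_self (μ := h) (fun p => ∏ a, ((p.1 : Matrix (Fin M) (Fin M) ℝ) * J *
    (p.2 : Matrix (Fin N) (Fin N) ℝ)ᵀ) (i a) (j a)) (1, ⟨R, hR⟩)]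
  simp

theorem sum_pairTensor_mul_conjMoment {s L : ℕ} [IsProbabilityMeasure h]
    (hLM : L ≤ M) (hMN : M ≤ N)
    (hJ : ∀ a b, J a b = if (a : ℕ) = (b : ℕ) ∧ (a : ℕ) < L then 1 else 0)
    {σ ν : Setoid (Fin s)} (hσ : IsPairing σ) (hν : IsPairing ν) :
    ∑ p, ∑ q, pairTensor σ p * pairTensor ν q * conjMoment h J p q
      = (L : ℝ) ^ Nat.card (Quotient (σ ⊔ ν)) := by
  simp only [conjMoment, ← integral_const_mul]
  have hint : ∀ p q, Integrable (fun x => pairTensor σ p * pairTensor ν q *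
      ∏ a, ((x.1 : Matrix (Fin M) (Fin M) ℝ) * J * (x.2 : Matrix (Fin N) (Fin N) ℝ)ᵀ)
        (p a) (q a)) h := fun p q => (integrable_prod_orthogonal_conj J p q).const_mul _
  simp only [← integral_finsetSum _ fun q _ => hint _ q]
  rw [← integral_finsetSum _ fun p _ => integrable_finsetSum _ fun q _ => hint p q]
  simp only [sum_pairTensor_mul_prod_orthogonal_conj hσ hν (SetLike.coe_mem _) (SetLike.coe_mem _),
    sum_pairTensor_mul_prod_partialIdentity hLM hMN σ ν hJ]
  simp

end Moments


/-- the moment formula for sums of non-overlapping coordinates over `O_{MN}^L`.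
In the Weingarten setup (`s = 2k`, pairings `P₂(s)`, Gram matrices `G_{sM}(π,σ) = M^{|π⊔σ|}`,
`G_{sN}(π,σ) = N^{|π⊔σ|}` invertible with inverses `W_{sM}`, `W_{sN}`, and `μ` the pushforward
of the Haar probability measure on `O(M) × O(N)` under `(A,B) ↦ A * J * Bᵀ`), for injective
`α : Fin K → Fin M` and `β : Fin K → Fin N`, the variable `χ(U) = ∑_t U (α t) (β t)` satisfies
`∫ χ(U)^s dμ(U) = ∑_{π,σ,τ,ν ∈ P₂(s)} K^{|π⊔τ|} L^{|σ⊔ν|} W_{sM} π σ W_{sN} τ ν`. -/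
theorem stmt_19 (k : ℕ) (hk : 1 ≤ k) (s : ℕ) (hs : s = 2 * k)
    (K L M N : ℕ) (hLM : L ≤ M) (hMN : M ≤ N) (hsM : s ≤ M) (hKM : K ≤ M) (hKN : K ≤ N)
    (G_M G_N W_M W_N : Matrix {π : Setoid (Fin s) // IsPairing π}
      {π : Setoid (Fin s) // IsPairing π} ℝ)
    (hGM : ∀ π σ, G_M π σ = (M : ℝ) ^ Nat.card (Quotient (π.1 ⊔ σ.1)))
    (hGN : ∀ π σ, G_N π σ = (N : ℝ) ^ Nat.card (Quotient (π.1 ⊔ σ.1)))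
    (hWM : G_M * W_M = 1 ∧ W_M * G_M = 1) (hWN : G_N * W_N = 1 ∧ W_N * G_N = 1)
    (J : Matrix (Fin M) (Fin N) ℝ)
    (hJ : ∀ a b, J a b = if (a : ℕ) = (b : ℕ) ∧ (a : ℕ) < L then 1 else 0)
    (h : Measure (↥(Matrix.orthogonalGroup (Fin M) ℝ) × ↥(Matrix.orthogonalGroup (Fin N) ℝ)))
    [IsProbabilityMeasure h] [h.IsMulLeftInvariant] [h.IsMulRightInvariant]
    (μ : Measure (Matrix (Fin M) (Fin N) ℝ))
    (hμ : μ = Measure.map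
      (fun p : ↥(Matrix.orthogonalGroup (Fin M) ℝ) × ↥(Matrix.orthogonalGroup (Fin N) ℝ) =>
        (p.1 : Matrix (Fin M) (Fin M) ℝ) * J * (p.2 : Matrix (Fin N) (Fin N) ℝ)ᵀ) h)
    (α : Fin K → Fin M) (β : Fin K → Fin N)
    (hα : Function.Injective α) (hβ : Function.Injective β) :
    ∫ U, (∑ t, U (α t) (β t)) ^ s ∂μ =
      ∑ π : {π : Setoid (Fin s) // IsPairing π}, ∑ σ : {π : Setoid (Fin s) // IsPairing π},
      ∑ τ : {π : Setoid (Fin s) // IsPairing π}, ∑ ν : {π : Setoid (Fin s) // IsPairing π},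
        (K : ℝ) ^ Nat.card (Quotient (π.1 ⊔ τ.1)) *
          (L : ℝ) ^ Nat.card (Quotient (σ.1 ⊔ ν.1)) * W_M π σ * W_N τ ν := by
  subst hμ
  have hmeas := measurable_matrix_of_apply (measurable_orthogonal_conj_apply J)
  have hchi : Measurable fun U : Matrix (Fin M) (Fin N) ℝ => (∑ t, U (α t) (β t)) ^ s :=
    (Finset.measurable_fun_sum _ fun t _ => measurable_matrix_apply (α t) (β t)).pow_const s
  rw [integral_map hmeas.aemeasurable hchi.aestronglyMeasurable]
  have hpow : ∀ U : Matrix (Fin M) (Fin N) ℝ, (∑ t, U (α t) (β t)) ^ s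
      = ∑ t : Fin s → Fin K, ∏ a, U (α (t a)) (β (t a)) := by
    intro U
    rw [← Fintype.prod_sum fun (_ : Fin s) (t : Fin K) => U (α t) (β t)]
    simp
  simp only [hpow]
  rw [integral_finsetSum _ fun t _ => integrable_prod_orthogonal_conj J (fun a => α (t a))
    fun a => β (t a)]
  have hX : ∀ (i : Fin s → Fin M) (j : Fin s → Fin N), conjMoment h J i j =
      ∑ π : {π : Setoid (Fin s) // IsPairing π}, ∑ σ : {π : Setoid (Fin s) // IsPairing π},
      ∑ τ : {π : Setoid (Fin s) // IsPairing π}, ∑ ν : {π : Setoid (Fin s) // IsPairing π},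
        pairTensor π.1 i * pairTensor τ.1 j *
          (L : ℝ) ^ Nat.card (Quotient (σ.1 ⊔ ν.1)) * W_M π σ * W_N τ ν := by
    intro i j
    rw [(conjMoment_orthInvariant_left (h := h) (J := J) j).eq_sum_weingarten hsM hGM hWM.2 i]
    refine Finset.sum_congr rfl fun π _ => Finset.sum_congr rfl fun σ _ => ?_
    simp only [fun p => (conjMoment_orthInvariant_right (h := h) (J := J) p).eq_sum_weingarten
      (hsM.trans hMN) hGN hWN.2 j, Finset.mul_sum]
    rw [Finset.sum_comm]
    refine Finset.sum_congr rfl fun τ _ => ?_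
    rw [Finset.sum_comm]
    refine Finset.sum_congr rfl fun ν _ => ?_
    rw [← sum_pairTensor_mul_conjMoment (h := h) hLM hMN hJ σ.2 ν.2]
    simp only [Finset.mul_sum, Finset.sum_mul]
    exact Finset.sum_congr rfl fun p _ => Finset.sum_congr rfl fun q _ => by ring
  change ∑ t : Fin s → Fin K, conjMoment h J (fun a => α (t a)) (fun a => β (t a)) = _
  simp only [hX, pairTensor_comp _ hα, pairTensor_comp _ hβ, pairTensor_mul]
  rw [Finset.sum_comm]
  refine Finset.sum_congr rfl fun π _ => ?_
  rw [Finset.sum_comm]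
  refine Finset.sum_congr rfl fun σ _ => ?_
  rw [Finset.sum_comm]
  refine Finset.sum_congr rfl fun τ _ => ?_
  rw [Finset.sum_comm]
  refine Finset.sum_congr rfl fun ν _ => ?_
  rw [← sum_pairTensor (n := K) (π.1 ⊔ τ.1)]
  simp only [Finset.sum_mul]
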